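/- Let ξ ∈ ℝ³ with |ξ'| > 0, k > 0, L > 0, τ > max(k, |ξ|/2), and let ζ₁ = ξ/2 + √(τ² - |ξ|²/4) η₁ - i√(τ² - k²) η₂ and ζ₂ = -ξ/2 + √(τ² - |ξ|²/4) η₁ + i√(τ² - k²) η₂, with η₁ = (1/|ξ'|)(ξ₂,-ξ₁,0) and η₂ = η₁ × (ξ/|ξ|). For x ∈ ℝ³ let ẋ = (x₁,x₂,-x₃) and ẍ = (x₁,x₂,2L-x₃). Then iζ₁·ẋ + conj(iζ₂)·ẍ = i ξ̇·x + iξ₃L - 2√(τ² - k²)(|ξ'|/|ξ|)L, where ξ̇ = (ξ₁, ξ₂, -ξ₃). -/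

import Mathlib

open Matrix Complex

noncomputable section

def nrm (x : Fin 3 → ℝ) : ℝ := Real.sqrt (x ⬝ᵥ x)

/-- View a real 3-vector as a complex 3-vector. -/
def cv (x : Fin 3 → ℝ) : Fin 3 → ℂ := fun j => (x j : ℂ)

theorem stmt_11 (ξ η₁ η₂ : Fin 3 → ℝ) (k L τ : ℝ)
    (hξ' : nrm ![ξ 0, ξ 1, 0] > 0)
    (hη₁ : η₁ = (1 / nrm ![ξ 0, ξ 1, 0]) • ![ξ 1, -ξ 0, 0])
    (hη₂ : η₂ = crossProduct η₁ ((1 / nrm ξ) • ξ))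
    (hk : 0 < k) (hL : 0 < L) (hτ : τ > max k (nrm ξ / 2))
    (ζ₁ ζ₂ : Fin 3 → ℂ)
    (hζ₁ : ζ₁ = fun j => (ξ j : ℂ) / 2
        + (Real.sqrt (τ^2 - (nrm ξ)^2 / 4) : ℝ) * (η₁ j : ℂ)
        - Complex.I * (Real.sqrt (τ^2 - k^2) : ℝ) * (η₂ j : ℂ))
    (hζ₂ : ζ₂ = fun j => -(ξ j : ℂ) / 2
        + (Real.sqrt (τ^2 - (nrm ξ)^2 / 4) : ℝ) * (η₁ j : ℂ)
        + Complex.I * (Real.sqrt (τ^2 - k^2) : ℝ) * (η₂ j : ℂ)) :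
    ∀ x : Fin 3 → ℝ,
      Complex.I * (ζ₁ ⬝ᵥ cv ![x 0, x 1, -x 2])
        + ((fun j => starRingEnd ℂ (Complex.I * ζ₂ j)) ⬝ᵥ cv ![x 0, x 1, 2 * L - x 2])
      = Complex.I * (cv ![ξ 0, ξ 1, -ξ 2] ⬝ᵥ cv x) + Complex.I * ξ 2 * L
        - 2 * (Real.sqrt (τ^2 - k^2) : ℝ) * (nrm ![ξ 0, ξ 1, 0] / nrm ξ : ℝ) * L := by
  intro x
  have hN : nrm ![ξ 0, ξ 1, 0] ^ 2 = ξ 0 ^ 2 + ξ 1 ^ 2 := by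
    unfold nrm
    rw [Real.sq_sqrt]
    · simp [dotProduct, Fin.sum_univ_three]; ring
    · simp [dotProduct, Fin.sum_univ_three]; nlinarith [sq_nonneg (ξ 0), sq_nonneg (ξ 1)]
  have h12 : η₁ 2 = 0 := by rw [hη₁]; simp
  have h22 : η₂ 2 = nrm ![ξ 0, ξ 1, 0] / nrm ξ := by
    have e : η₂ 2 = (ξ 0 ^ 2 + ξ 1 ^ 2) / nrm ![ξ 0, ξ 1, 0] / nrm ξ := by
      rw [hη₂, hη₁]
      simp [crossProduct]
      ring
    rw [e, ← hN, pow_two, mul_div_assoc, div_self hξ'.ne', mul_one]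
  rw [← h22, hζ₁, hζ₂]
  generalize Real.sqrt (τ^2 - (nrm ξ)^2 / 4) = a
  generalize Real.sqrt (τ^2 - k^2) = b
  simp only [dotProduct, Fin.sum_univ_three, cv, map_add, map_sub, map_mul, map_neg, map_div₀,
    Complex.conj_I, Complex.conj_ofReal, map_ofNat, h12]
  simp
  ring_nf
  simp only [Complex.I_sq]
  ring
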